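/- Let R := R_{−1}(π/3) on (ℂ²)^{⊗3} ≅ ℂ⁸ (the Kitaev–Wang generalized Yang–Baxter operator for SO(3)₂) and define E := I₈ + (2i sin(π/3))^{−1}(R − R^{−1}), so that the skein identity R − R^{−1} = −2i sin(π/3)(I₈ − E) holds by construction. Then E² = 2E and R ∘ E = e^{2πi/3} E. -/

import Mathlib

open Matrix

/-- The generalized Yang-Baxter operator `R_ν(θ)` on `(ℂ²)^{⊗3}`, given in the
lexicographically ordered basis `e_{(i₁,i₂,i₃)}` by the block-diagonal matrix `diag(A,B)`
with `A = [[νC,0,iS,0],[0,−iS,0,C],[iS,0,νC,0],[0,C,0,−iS]]` (acting on `i₁ = 0`) and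
`B = [[−iS,0,C,0],[0,νC,0,iS],[C,0,−iS,0],[0,iS,0,νC]]` (acting on `i₁ = 1`),
where `C = cos θ`, `S = sin θ`.  Equivalently: the entry at `((i₁,i₂,i₃),(j₁,j₂,j₃))`
vanishes unless `i₁ = j₁` and `i₃ = j₃`, and in the `i₂,j₂` indices it is the 2×2 block
`[[νC,iS],[iS,νC]]` if `i₁ = i₃`, and `[[−iS,C],[C,−iS]]` if `i₁ ≠ i₃`. -/
noncomputable def gYB (ν : ℂ) (θ : ℝ) :
    Matrix (Fin 2 × Fin 2 × Fin 2) (Fin 2 × Fin 2 × Fin 2) ℂ :=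
  Matrix.of fun p q =>
    if p.1 = q.1 ∧ p.2.2 = q.2.2 then
      if p.1 = p.2.2 then
        if p.2.1 = q.2.1 then ν * (Real.cos θ : ℂ) else Complex.I * (Real.sin θ : ℂ)
      else
        if p.2.1 = q.2.1 then -(Complex.I * (Real.sin θ : ℂ)) else (Real.cos θ : ℂ)
    else 0

/-- The matrix which is `[[1,1],[1,1]]` in the middle indices when the outer indices agree,
and vanishes otherwise. -/
noncomputable def gYBCup : Matrix (Fin 2 × Fin 2 × Fin 2) (Fin 2 × Fin 2 × Fin 2) ℂ :=
  Matrix.of fun p q => if p.1 = q.1 ∧ p.2.2 = q.2.2 ∧ p.1 = p.2.2 then 1 else 0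

theorem gYB_mul_gYB_neg {ν : ℂ} (hν : ν ^ 2 = 1) (θ : ℝ) : gYB ν θ * gYB ν (-θ) = 1 := by
  have h := Complex.sin_sq_add_cos_sq (θ : ℂ)
  have hI := Complex.I_sq
  ext ⟨a, b, c⟩ ⟨d, e, f⟩
  fin_cases a <;> fin_cases b <;> fin_cases c <;> fin_cases d <;> fin_cases e <;> fin_cases f <;>
    simp [gYB, Matrix.mul_apply, Fintype.sum_prod_type] <;> grind

theorem gYB_inv {ν : ℂ} (hν : ν ^ 2 = 1) (θ : ℝ) : (gYB ν θ)⁻¹ = gYB ν (-θ) :=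
  Matrix.inv_eq_right_inv (gYB_mul_gYB_neg hν θ)

theorem gYB_sub_gYB_neg (ν : ℂ) (θ : ℝ) :
    gYB ν θ - gYB ν (-θ) = (2 * Complex.I * (Real.sin θ : ℂ)) • (gYBCup - 1) := by
  ext ⟨a, b, c⟩ ⟨d, e, f⟩
  fin_cases a <;> fin_cases b <;> fin_cases c <;> fin_cases d <;> fin_cases e <;> fin_cases f <;>
    simp [gYB, gYBCup] <;> ring

theorem gYBCup_mul_self : gYBCup * gYBCup = (2 : ℂ) • gYBCup := by
  ext ⟨a, b, c⟩ ⟨d, e, f⟩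
  fin_cases a <;> fin_cases b <;> fin_cases c <;> fin_cases d <;> fin_cases e <;> fin_cases f <;>
    simp [gYBCup, Matrix.mul_apply, Fintype.sum_prod_type]

theorem gYB_mul_gYBCup (ν : ℂ) (θ : ℝ) :
    gYB ν θ * gYBCup = (ν * (Real.cos θ : ℂ) + Complex.I * (Real.sin θ : ℂ)) • gYBCup := by
  ext ⟨a, b, c⟩ ⟨d, e, f⟩
  fin_cases a <;> fin_cases b <;> fin_cases c <;> fin_cases d <;> fin_cases e <;> fin_cases f <;>
    simp [gYB, gYBCup, Matrix.mul_apply, Fintype.sum_prod_type] <;> ring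

theorem exp_two_pi_mul_I_div_three :
    Complex.exp (2 * (Real.pi : ℂ) * Complex.I / 3) =
      -1 * (Real.cos (Real.pi / 3) : ℂ) + Complex.I * (Real.sin (Real.pi / 3) : ℂ) := by
  have h : 2 * (Real.pi : ℂ) * Complex.I / 3 =
      ((Real.pi - Real.pi / 3 : ℝ) : ℂ) * Complex.I := by
    push_cast
    ring
  rw [h, Complex.exp_mul_I, ← Complex.ofReal_cos, ← Complex.ofReal_sin, Real.cos_pi_sub,
    Real.sin_pi_sub]
  push_cast
  ring

/-- for `R := R_{−1}(π/3)` (the Kitaev–Wang generalized Yang–Baxter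
operator for `SO(3)₂`) and `E := I₈ + (2i sin(π/3))⁻¹ (R − R⁻¹)` (so that the skein
identity `R − R⁻¹ = −2i sin(π/3)(I₈ − E)` holds by construction), one has
`E² = 2E` and `R ∘ E = e^{2πi/3} E`. -/
theorem stmt_10
    (R E : Matrix (Fin 2 × Fin 2 × Fin 2) (Fin 2 × Fin 2 × Fin 2) ℂ)
    (hR : R = gYB (-1) (Real.pi / 3))
    (hE : E = 1 + (2 * Complex.I * (Real.sin (Real.pi / 3) : ℂ))⁻¹ • (R - R⁻¹)) :
    E * E = (2 : ℂ) • E ∧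
      R * E = Complex.exp (2 * (Real.pi : ℂ) * Complex.I / 3) • E := by
  have hS : 2 * Complex.I * (Real.sin (Real.pi / 3) : ℂ) ≠ 0 := by
    have h : Real.sin (Real.pi / 3) ≠ 0 :=
      (Real.sin_pos_of_pos_of_lt_pi (by positivity) (by linarith [Real.pi_pos])).ne'
    exact mul_ne_zero (mul_ne_zero two_ne_zero Complex.I_ne_zero) (Complex.ofReal_ne_zero.mpr h)
  have hcup : E = gYBCup := by
    rw [hE, hR, gYB_inv (by norm_num), gYB_sub_gYB_neg, inv_smul_smul₀ hS,
      add_sub_cancel]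
  rw [hcup, hR, exp_two_pi_mul_I_div_three]
  exact ⟨gYBCup_mul_self, gYB_mul_gYBCup _ _⟩
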